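/- arXiv:math/9801153 — 7 statements merged into one kernel-verified Lean document; each statement's English description precedes it below -/
import Mathlib

section
/- Let D be a countably complete filter on an infinite set κ, let B = P(κ)/D, let E be an ultrafilter on B, and let F = {A ⊆ κ : [A]_D ∈ E}. For f : κ → ω let f̂ : ω → B be defined by f̂(n) = [f⁻¹(n)]_D; then f̂ ∈ B^(ω), and the map i defined by i(f_F) = (f̂)_E is a well-defined order isomorphism from the ultrapower ω^κ/F onto the Boolean ultrapower ω^B/E. -/
open Filter

/-- The Boolean algebra of germs of a Boolean algebra `β` modulo a filter `l`:
for `β = Prop` this is the quotient Boolean algebra `P(κ)/D` of the powerset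
algebra by (the dual ideal of) the filter. -/
instance Filter.Germ.instComplementedLattice {ι : Type*} (l : Filter ι) {β : Type*}
    [BooleanAlgebra β] : ComplementedLattice (Germ l β) where
  exists_isCompl a := Germ.inductionOn a fun f => by
    refine ⟨Germ.ofFun (fun x => (f x)ᶜ), ?_, ?_⟩
    · rw [disjoint_iff]
      show ((↑f : Germ l β) ⊓ ↑(fun x => (f x)ᶜ)) = ⊥
      rw [← Germ.const_bot (l := l)]
      exact Germ.coe_eq.2 (Eventually.of_forall fun x => by simp)
    · rw [codisjoint_iff]
      show ((↑f : Germ l β) ⊔ ↑(fun x => (f x)ᶜ)) = ⊤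
      rw [← Germ.const_top (l := l)]
      exact Germ.coe_eq.2 (Eventually.of_forall fun x => by simp)

noncomputable instance Filter.Germ.instBooleanAlgebra {ι : Type*} (l : Filter ι) {β : Type*}
    [BooleanAlgebra β] : BooleanAlgebra (Germ l β) :=
  DistribLattice.booleanAlgebraOfComplemented _

/-- The equivalence class `[A]_D` of a set `A ⊆ κ` in the quotient Boolean algebra
`P(κ)/D`, realized as the germ of the indicator (`Prop`-valued) function of `A`. -/
def classOf {κ : Type*} (D : Filter κ) (A : Set κ) : Filter.Germ D Prop :=
  Filter.Germ.ofFun (fun x => x ∈ A)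

/-- An ultrafilter on a Boolean algebra `B`: a subset not containing `⊥`, closed
upward and under finite meets, containing `b` or `bᶜ` for every `b`. -/
def IsUltrafilterOn {B : Type*} [BooleanAlgebra B] (E : Set B) : Prop :=
  ⊥ ∉ E ∧ (∀ a ∈ E, ∀ b : B, a ≤ b → b ∈ E) ∧
    (∀ a ∈ E, ∀ b ∈ E, a ⊓ b ∈ E) ∧ ∀ b : B, b ∈ E ∨ bᶜ ∈ E

theorem classOf_le_iff {κ : Type*} {D : Filter κ} {A B : Set κ} :
    classOf D A ≤ classOf D B ↔ ∀ᶠ x in D, x ∈ A → x ∈ B :=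
  Germ.coe_le

theorem classOf_inter {κ : Type*} (D : Filter κ) (A B : Set κ) :
    classOf D (A ∩ B) = classOf D A ⊓ classOf D B :=
  rfl

theorem exists_classOf_eq {κ : Type*} (D : Filter κ) (b : Germ D Prop) :
    ∃ A : Set κ, classOf D A = b :=
  Germ.inductionOn b fun f => ⟨{x | f x}, rfl⟩

theorem classOf_univ {κ : Type*} (D : Filter κ) : classOf D Set.univ = ⊤ := by
  refine top_unique ?_
  obtain ⟨A, hA⟩ := exists_classOf_eq D ⊤
  rw [← hA, classOf_le_iff]
  exact Eventually.of_forall fun x _ => Set.mem_univ x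

theorem classOf_empty {κ : Type*} (D : Filter κ) : classOf D ∅ = ⊥ := by
  refine bot_unique ?_
  obtain ⟨A, hA⟩ := exists_classOf_eq D ⊥
  rw [← hA, classOf_le_iff]
  exact Eventually.of_forall fun x hx => hx.elim

/-- Modulo a countably complete filter, the class of a countable union is the supremum of the
classes. -/
theorem isLUB_range_classOf {κ ι : Type*} [Countable ι] (D : Filter κ) [CountableInterFilter D]
    (A : ι → Set κ) : IsLUB (Set.range fun i => classOf D (A i)) (classOf D (⋃ i, A i)) := by
  constructor
  · rintro _ ⟨i, rfl⟩
    exact classOf_le_iff.2 (Eventually.of_forall fun x hx => Set.mem_iUnion.2 ⟨i, hx⟩)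
  · intro b hb
    obtain ⟨B, rfl⟩ := exists_classOf_eq D b
    have h : ∀ᶠ x in D, ∀ i, x ∈ A i → x ∈ B :=
      eventually_countable_forall.2 fun i => classOf_le_iff.1 (hb ⟨i, rfl⟩)
    refine classOf_le_iff.2 (h.mono fun x hx hxA => ?_)
    obtain ⟨i, hi⟩ := Set.mem_iUnion.1 hxA
    exact hx i hi

theorem isLUB_classOf_eq {κ : Type*} (D : Filter κ) [CountableInterFilter D] (f g : κ → ℕ) :
    IsLUB {x | ∃ n : ℕ, x = classOf D (f ⁻¹' {n}) ⊓ classOf D (g ⁻¹' {n})}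
      (classOf D {x | f x = g x}) := by
  convert isLUB_range_classOf D fun n : ℕ => f ⁻¹' {n} ∩ g ⁻¹' {n} using 1
  · ext b
    simp only [Set.mem_ofPred_eq, Set.mem_range, classOf_inter, eq_comm]
  · congr 1
    ext x
    simp [eq_comm]

theorem isLUB_classOf_lt {κ : Type*} (D : Filter κ) [CountableInterFilter D] (f g : κ → ℕ) :
    IsLUB {x | ∃ m n : ℕ, m < n ∧ x = classOf D (f ⁻¹' {m}) ⊓ classOf D (g ⁻¹' {n})}
      (classOf D {x | f x < g x}) := by
  convert isLUB_range_classOf D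
    fun p : {p : ℕ × ℕ // p.1 < p.2} => f ⁻¹' {p.1.1} ∩ g ⁻¹' {p.1.2} using 1
  · ext b
    constructor
    · rintro ⟨m, n, h, rfl⟩
      exact ⟨⟨(m, n), h⟩, rfl⟩
    · rintro ⟨⟨⟨m, n⟩, h⟩, rfl⟩
      exact ⟨m, n, h, rfl⟩
  · congr 1
    ext x
    simp

theorem IsUltrafilterOn.top_mem {B : Type*} [BooleanAlgebra B] {E : Set B}
    (hE : IsUltrafilterOn E) : ⊤ ∈ E := by
  rcases hE.2.2.2 ⊤ with h | h
  · exact h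
  · exact (hE.1 (compl_top (α := B) ▸ h)).elim

/-- A countable family of classes with supremum `⊤` is met by the fibres of a function choosing,
for almost every point, a representing set that contains it. -/
theorem exists_isLUB_classOf_preimage_inf {κ : Type*} (D : Filter κ) [CountableInterFilter D]
    (t : ℕ → Germ D Prop) (ht : IsLUB (Set.range t) ⊤) :
    ∃ f : κ → ℕ, IsLUB {x | ∃ n : ℕ, x = classOf D (f ⁻¹' {n}) ⊓ t n} ⊤ := by
  classical
  choose A hA using fun n => exists_classOf_eq D (t n)
  obtain rfl : (fun n => classOf D (A n)) = t := funext hA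
  let f : κ → ℕ := fun x => if h : ∃ n, x ∈ A n then Nat.find h else 0
  have hf : ⋃ n, f ⁻¹' {n} ∩ A n = ⋃ n, A n := by
    refine (Set.iUnion_mono fun n => Set.inter_subset_right).antisymm fun x hx => ?_
    have h := Set.mem_iUnion.1 hx
    refine Set.mem_iUnion.2 ⟨f x, rfl, ?_⟩
    simp only [f, dif_pos h]
    exact Nat.find_spec h
  refine ⟨f, ?_⟩
  rw [ht.unique (isLUB_range_classOf D A), ← hf]
  convert isLUB_range_classOf D fun n : ℕ => f ⁻¹' {n} ∩ A n using 1
  ext b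
  simp only [Set.mem_ofPred_eq, Set.mem_range, classOf_inter, eq_comm]

/-- Let `D` be a countably complete filter on an infinite set `κ`, `B = P(κ)/D`,
`E` an ultrafilter on `B`, and `F = {A : [A]_D ∈ E}`.  For `f : κ → ω` let
`f̂ : ω → B`, `f̂ n = [f⁻¹(n)]_D`.  Then `f̂ ∈ B^(ω)` (it is a partition of unity),
and `i(f_F) = (f̂)_E` is a well-defined order isomorphism from `ω^κ/F` onto the
Boolean ultrapower `ω^B/E`; this is expressed on representatives:
`f ∼_F g ↔ [[f̂ = ĝ]] ∈ E` (well-definedness and injectivity),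
`f <_F g ↔ [[f̂ < ĝ]] ∈ E` (order preservation), and every `t ∈ B^(ω)` is
`E`-equivalent to some `f̂` (surjectivity).  Here `[[s = t]]` and `[[s < t]]` are the
suprema of `{s n ⊓ t n : n}` and `{s m ⊓ t n : m < n}`, referred to via `IsLUB`. -/
theorem ultrapower_iso_boolean_ultrapower {κ : Type*} [Infinite κ]
    (D : Filter κ) [D.NeBot] [CountableInterFilter D]
    (E : Set (Filter.Germ D Prop)) (hE : IsUltrafilterOn E)
    (F : Set (Set κ)) (hF : F = {A : Set κ | classOf D A ∈ E}) :
    -- f̂ belongs to B^(ω)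
    (∀ f : κ → ℕ,
      (∀ m n : ℕ, m ≠ n → classOf D (f ⁻¹' {m}) ⊓ classOf D (f ⁻¹' {n}) = ⊥) ∧
      IsLUB (Set.range fun n => classOf D (f ⁻¹' {n})) ⊤) ∧
    -- i is well defined and one-to-one
    (∀ f g : κ → ℕ,
      {x | f x = g x} ∈ F ↔
        ∀ b, IsLUB {x | ∃ n : ℕ, x = classOf D (f ⁻¹' {n}) ⊓ classOf D (g ⁻¹' {n})} b →
          b ∈ E) ∧
    -- i preserves the order
    (∀ f g : κ → ℕ,
      {x | f x < g x} ∈ F ↔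
        ∀ b,
          IsLUB {x | ∃ m n : ℕ, m < n ∧ x = classOf D (f ⁻¹' {m}) ⊓ classOf D (g ⁻¹' {n})} b →
          b ∈ E) ∧
    -- i is onto
    (∀ t : ℕ → Filter.Germ D Prop,
      (∀ m n : ℕ, m ≠ n → t m ⊓ t n = ⊥) → IsLUB (Set.range t) ⊤ →
      ∃ f : κ → ℕ,
        ∀ b, IsLUB {x | ∃ n : ℕ, x = classOf D (f ⁻¹' {n}) ⊓ t n} b → b ∈ E) := by
  have mem_iff {S : Set (Germ D Prop)} {A : Set κ} (h : IsLUB S (classOf D A)) :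
      A ∈ F ↔ ∀ b, IsLUB S b → b ∈ E := by
    rw [hF]
    exact ⟨fun hA b hb => hb.unique h ▸ hA, fun H => H _ h⟩
  refine ⟨fun f => ⟨fun m n hmn => ?_, ?_⟩, fun f g => mem_iff (isLUB_classOf_eq D f g),
    fun f g => mem_iff (isLUB_classOf_lt D f g), fun t _ ht => ?_⟩
  · have hdisj : f ⁻¹' {m} ∩ f ⁻¹' {n} = ∅ :=
      ((Set.disjoint_singleton.2 hmn).preimage f).inter_eq
    rw [← classOf_inter, hdisj, classOf_empty]
  · have hcover : ⋃ n, f ⁻¹' {n} = Set.univ := by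
      rw [← Set.preimage_iUnion, Set.iUnion_of_singleton, Set.preimage_univ]
    rw [← classOf_univ, ← hcover]
    exact isLUB_range_classOf D fun n => f ⁻¹' {n}
  · obtain ⟨f, hf⟩ := exists_isLUB_classOf_preimage_inf D t ht
    exact ⟨f, fun b hb => hb.unique hf ▸ hE.top_mem⟩
end

section
/- Let κ be an infinite cardinal, let B be a Boolean algebra, and let C be a dense subalgebra of B such that every antichain in C has size at most κ. Then every element b of B is the supremum in B of an antichain of C of size at most κ consisting of elements below b, and consequently the cardinality of B is at most |C|^κ. -/
/-- `C` is a subalgebra of the Boolean algebra `B` (as a subset closed under the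
Boolean operations). -/
def IsSubalgebraSet {B : Type*} [BooleanAlgebra B] (C : Set B) : Prop :=
  ⊥ ∈ C ∧ ⊤ ∈ C ∧ (∀ x ∈ C, xᶜ ∈ C) ∧ ∀ x ∈ C, ∀ y ∈ C, x ⊔ y ∈ C

/-- Below every element `b`, a dense set containing `⊥` has an antichain with supremum `b`, which
may be chosen to contain `⊥`. -/
theorem exists_antichain_isLUB_of_dense {B : Type*} [BooleanAlgebra B] {C : Set B}
    (hbot : ⊥ ∈ C) (hdense : ∀ b : B, b ≠ ⊥ → ∃ c ∈ C, c ≠ ⊥ ∧ c ≤ b) (b : B) :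
    ∃ A : Set B, A ⊆ C ∧ (A.Pairwise fun x y => x ⊓ y = ⊥) ∧ ⊥ ∈ A ∧ IsLUB A b := by
  obtain ⟨A, hbotA, hA⟩ := zorn_subset_nonempty
    {A : Set B | A ⊆ C ∧ (A.Pairwise fun x y => x ⊓ y = ⊥) ∧ ∀ a ∈ A, a ≤ b}
    (fun c hc hchain _ => ⟨⋃₀ c, ⟨Set.sUnion_subset fun s hs => (hc hs).1,
      (Set.pairwise_sUnion hchain.directedOn).2 fun s hs => (hc hs).2.1,
      fun a ⟨s, hs, ha⟩ => (hc hs).2.2 a ha⟩, fun s hs => Set.subset_sUnion_of_mem hs⟩)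
    {⊥} ⟨by simpa using hbot, Set.pairwise_singleton _ _, by simp⟩
  obtain ⟨hAC, hAp, hAb⟩ := hA.prop
  refine ⟨A, hAC, hAp, hbotA rfl, hAb, fun u hu => ?_⟩
  by_contra hbu
  obtain ⟨c, hcC, hc0, hc⟩ := hdense (b \ u) (by rwa [Ne, sdiff_eq_bot_iff])
  have hcu : Disjoint c u := disjoint_sdiff_self_left.mono_left hc
  have hcA : c ∈ A := by
    refine hA.le_of_ge ⟨Set.insert_subset hcC hAC, hAp.insert fun a ha _ => ?_, ?_⟩
      (Set.subset_insert c A) (Set.mem_insert c A)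
    · have hca := hcu.mono_right (hu ha)
      exact ⟨hca.eq_bot, hca.symm.eq_bot⟩
    · rintro a (rfl | ha)
      exacts [hc.trans sdiff_le, hAb a ha]
  exact hc0 (hcu.eq_bot_of_le (hu hcA))

/-- If every element of a partial order is the supremum of a nonempty subset of `C` of size at most
`κ`, then the order has cardinality at most `|C| ^ κ`. -/
theorem mk_le_power_of_forall_exists_isLUB {B : Type u} [PartialOrder B] {C : Set B}
    {κ : Cardinal.{u}}
    (h : ∀ b : B, ∃ A : Set B, A ⊆ C ∧ A.Nonempty ∧ Cardinal.mk A ≤ κ ∧ IsLUB A b) :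
    Cardinal.mk B ≤ Cardinal.mk C ^ κ := by
  induction κ using Cardinal.inductionOn with | _ ι
  have hf : ∀ b : B, ∃ f : ι → C, IsLUB (Set.range fun i => (f i : B)) b := fun b => by
    obtain ⟨A, hAC, hne, ⟨e⟩, hb⟩ := h b
    have := hne.to_subtype
    refine ⟨fun i => Set.inclusion hAC (Function.invFun e i), ?_⟩
    have hrange : (Set.range fun i => (Set.inclusion hAC (Function.invFun e i) : B)) = A :=
      ((Function.invFun_surjective e.injective).range_comp Subtype.val).trans Subtype.range_coe
    rwa [hrange]
  choose f hf using hf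
  rw [Cardinal.power_def]
  exact Cardinal.mk_le_of_injective (f := f) fun a b hab => (hf a).unique (hab ▸ hf b)

/-- Let `κ` be an infinite cardinal, `B` a Boolean algebra and `C` a dense subalgebra
of `B` all of whose antichains have size at most `κ`.  Then every `b ∈ B` is the
supremum (in `B`) of an antichain of `C` of size at most `κ` consisting of elements
below `b`; consequently `|B| ≤ |C| ^ κ`. -/
theorem card_le_of_dense_subalgebra {B : Type u} [BooleanAlgebra B]
    (κ : Cardinal.{u}) (hκ : Cardinal.aleph0 ≤ κ)
    (C : Set B) (hC : IsSubalgebraSet C)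
    (hdense : ∀ b : B, b ≠ ⊥ → ∃ c ∈ C, c ≠ ⊥ ∧ c ≤ b)
    (hanti : ∀ A : Set B, A ⊆ C → (A.Pairwise fun x y => x ⊓ y = ⊥) →
      Cardinal.mk A ≤ κ) :
    (∀ b : B, ∃ A : Set B, A ⊆ C ∧ (A.Pairwise fun x y => x ⊓ y = ⊥) ∧
      Cardinal.mk A ≤ κ ∧ (∀ a ∈ A, a ≤ b) ∧ IsLUB A b) ∧
      Cardinal.mk B ≤ Cardinal.mk C ^ κ := by
  have key := exists_antichain_isLUB_of_dense hC.1 hdense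
  refine ⟨fun b => ?_, mk_le_power_of_forall_exists_isLUB fun b => ?_⟩
  · obtain ⟨A, hAC, hAp, -, hb⟩ := key b
    exact ⟨A, hAC, hAp, hanti A hAC hAp, hb.1, hb⟩
  · obtain ⟨A, hAC, hAp, hbot, hb⟩ := key b
    exact ⟨A, hAC, ⟨⊥, hbot⟩, hanti A hAC hAp, hb⟩
end

section
/- Let κ be a regular uncountable cardinal, let B be a countably complete Boolean algebra, and let C ⊆ B be a κ-complete dense subalgebra in which every antichain has size at most κ. Let E be an ultrafilter on B with the property that for every maximal antichain A of C there exists A' ⊆ A with |A'| < κ and ⋁A' ∈ E. Then for every t ∈ B^(ω) there exists s ∈ B^(ω) with s(n) ∈ C for all n ∈ ω and [[t = s]] ∈ E. Consequently the cardinality of the Boolean ultrapower ω^B/E is at most |C|^ω. -/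
/-- `t ∈ B^(ω)`: a sequence with pairwise disjoint terms and supremum `⊤`. -/
def IsPartitionSeq {B : Type*} [BooleanAlgebra B] [SupSet B] (t : ℕ → B) : Prop :=
  (∀ m n : ℕ, m ≠ n → t m ⊓ t n = ⊥) ∧ (⨆ n, t n) = ⊤

/-- `[[s = t]] = ⋁ₙ (s n ⊓ t n)`. -/
def eqBB {B : Type*} [BooleanAlgebra B] [SupSet B] (s t : ℕ → B) : B :=
  sSup {x | ∃ n : ℕ, x = s n ⊓ t n}

/-- `A` is an antichain contained in `C`. -/
def IsAntichainIn {B : Type*} [BooleanAlgebra B] (C A : Set B) : Prop :=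
  A ⊆ C ∧ A.Pairwise fun x y => x ⊓ y = ⊥

/-- `A` is a maximal antichain in `C`. -/
def IsMaxAntichainIn {B : Type*} [BooleanAlgebra B] (C A : Set B) : Prop :=
  IsAntichainIn C A ∧ ∀ A' : Set B, IsAntichainIn C A' → A ⊆ A' → A' = A

/-- A dense subset `D` of `C` with `⊥ ∈ D` contains a maximal antichain of `C`. -/
theorem exists_isMaxAntichainIn_subset {B : Type*} [BooleanAlgebra B] {C D : Set B}
    (hDC : D ⊆ C) (hbot : ⊥ ∈ D) (hD : ∀ c ∈ C, c ≠ ⊥ → ∃ d ∈ D, d ≠ ⊥ ∧ d ≤ c) :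
    ∃ A ⊆ D, IsMaxAntichainIn C A := by
  obtain ⟨A, hA⟩ := zorn_subset {A : Set B | IsAntichainIn D A} (by
    intro c hc hchain
    refine ⟨⋃₀ c, ⟨Set.sUnion_subset fun s hs => (hc hs).1, ?_⟩,
      fun s hs => Set.subset_sUnion_of_mem hs⟩
    exact (Set.pairwise_sUnion hchain.directedOn).2 fun s hs => (hc hs).2)
  have hAD : IsAntichainIn D A := hA.prop
  have mem_of_disjoint : ∀ d ∈ D, (∀ a ∈ A, d ≠ a → d ⊓ a = ⊥) → d ∈ A := by
    intro d hd h
    refine hA.le_of_ge (y := insert d A) ⟨Set.insert_subset hd hAD.1, ?_⟩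
      (Set.subset_insert d A) (Set.mem_insert d A)
    refine hAD.2.insert fun a ha hne => ?_
    exact ⟨h a ha hne, by rw [inf_comm]; exact h a ha hne⟩
  refine ⟨A, hAD.1, ⟨hAD.1.trans hDC, hAD.2⟩, fun A' hA' hsub => ?_⟩
  refine (Set.Subset.antisymm hsub fun x hx => ?_).symm
  by_contra hxA
  by_cases hx0 : x = ⊥
  · subst hx0
    exact hxA (mem_of_disjoint ⊥ hbot fun a _ _ => bot_inf_eq a)
  · obtain ⟨d, hd, hd0, hdx⟩ := hD x (hA'.1 hx) hx0
    have hdA : d ∈ A := by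
      refine mem_of_disjoint d hd fun a ha _ => ?_
      have hxa : x ⊓ a = ⊥ := hA'.2 hx (hsub ha) fun h => hxA (h ▸ ha)
      exact le_bot_iff.1 ((inf_le_inf_right a hdx).trans hxa.le)
    have hdx' : d ⊓ x = ⊥ := hA'.2 (hsub hdA) hx fun h => hxA (h ▸ hdA)
    exact hd0 (by rwa [inf_eq_left.2 hdx] at hdx')

/-- Every nonzero element of `B` has a nonzero lower bound in `C` that lies below some term of a
given partition. -/
theorem exists_le_partition_term {B : Type*} [BooleanAlgebra B] [SupSet B]
    (hB : ∀ S : Set B, S.Countable → IsLUB S (sSup S)) {C : Set B}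
    (hdense : ∀ b : B, b ≠ ⊥ → ∃ c ∈ C, c ≠ ⊥ ∧ c ≤ b) {t : ℕ → B} (ht : IsPartitionSeq t)
    {c : B} (hc : c ≠ ⊥) : ∃ d ∈ {d ∈ C | ∃ n, d ≤ t n}, d ≠ ⊥ ∧ d ≤ c := by
  have hlub : IsLUB (Set.range t) ⊤ := ht.2 ▸ hB _ (Set.countable_range t)
  obtain ⟨n, hn⟩ : ∃ n, c ⊓ t n ≠ ⊥ := by
    by_contra! h
    refine hc (compl_eq_top.1 (top_le_iff.1 (hlub.2 ?_)))
    rintro _ ⟨n, rfl⟩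
    exact (disjoint_iff.2 (h n)).le_compl_left
  obtain ⟨d, hdC, hd0, hd⟩ := hdense _ hn
  exact ⟨d, ⟨hdC, n, hd.trans inf_le_right⟩, hd0, hd.trans inf_le_left⟩

/-- Elements of `A` below terms of a partition `t` can be collected into a partition in `C` that
agrees with `t` at least on `sSup A`. -/
theorem exists_partition_eqBB_ge {B : Type*} [BooleanAlgebra B] [SupSet B]
    (hB : ∀ S : Set B, S.Countable → IsLUB S (sSup S)) {C : Set B} (hC : IsSubalgebraSet C)
    {A : Set B} (hA : ∀ S ⊆ A, IsLUB S (sSup S) ∧ sSup S ∈ C)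
    {t : ℕ → B} (ht : IsPartitionSeq t) (hAt : ∀ a ∈ A, ∃ n, a ≤ t n) :
    ∃ s : ℕ → B, IsPartitionSeq s ∧ (∀ n, s n ∈ C) ∧ sSup A ≤ eqBB t s := by
  choose! f hf using hAt
  set r : ℕ → B := fun n => sSup {a ∈ A | f a = n} with hr
  have hrlub (n : ℕ) : IsLUB {a ∈ A | f a = n} (r n) := (hA _ (Set.sep_subset _ _)).1
  have hrC (n : ℕ) : r n ∈ C := (hA _ (Set.sep_subset _ _)).2
  obtain ⟨hlub, hmem⟩ := hA A subset_rfl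
  have hrt (n : ℕ) : r n ≤ t n := (hrlub n).2 fun a ha => ha.2 ▸ hf a ha.1
  have hrA (n : ℕ) : r n ≤ sSup A := (hrlub n).2 fun a ha => hlub.1 ha.1
  have har (a : B) (ha : a ∈ A) : a ≤ r (f a) := (hrlub _).1 ⟨ha, rfl⟩
  set s : ℕ → B := fun n => if n = 0 then r n ⊔ (sSup A)ᶜ else r n with hs
  have hrs (n : ℕ) : r n ≤ s n := by
    by_cases h : n = 0 <;> simp [hs, h]
  have hrr (m n : ℕ) (h : m ≠ n) : Disjoint (r m) (r n) :=
    (disjoint_iff.2 (ht.1 m n h)).mono (hrt m) (hrt n)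
  have hcr (n : ℕ) : Disjoint (sSup A)ᶜ (r n) := disjoint_compl_left.mono_right (hrA n)
  refine ⟨s, ⟨fun m n hmn => ?_, ?_⟩, fun n => ?_, hlub.2 fun a ha => ?_⟩
  · rw [← disjoint_iff]
    by_cases hm : m = 0
    · have hn : n ≠ 0 := fun h => hmn (hm.trans h.symm)
      simpa [hs, hm, hn] using And.intro (hrr 0 n hn.symm) (hcr n)
    · by_cases hn : n = 0
      · simpa [hs, hm, hn] using And.intro (hrr m 0 hm) (hcr m).symm
      · simpa [hs, hm, hn] using hrr m n hmn
  · have hub := (hB _ (Set.countable_range s)).1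
    have hle (n : ℕ) : s n ≤ ⨆ n, s n := hub ⟨n, rfl⟩
    have h1 : sSup A ≤ ⨆ n, s n :=
      hlub.2 fun a ha => (har a ha).trans ((hrs _).trans (hle _))
    have h2 : (sSup A)ᶜ ≤ ⨆ n, s n := le_trans (by simp [hs]) (hle 0)
    exact top_le_iff.1 (sup_compl_eq_top (x := sSup A) ▸ sup_le h1 h2)
  · by_cases h : n = 0
    · simpa only [hs, h, if_true] using hC.2.2.2 _ (hrC 0) _ (hC.2.2.1 _ hmem)
    · simpa only [hs, h, if_false] using hrC n
  · have hcount : {x | ∃ n : ℕ, x = t n ⊓ s n}.Countable := by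
      refine (Set.countable_range fun n => t n ⊓ s n).mono ?_
      rintro x ⟨n, rfl⟩
      exact ⟨n, rfl⟩
    exact (le_inf (hf a ha) ((har a ha).trans (hrs _))).trans ((hB _ hcount).1 ⟨f a, rfl⟩)

/-- Let `κ` be regular uncountable, `B` a countably complete Boolean algebra, `C` a
`κ`-complete dense subalgebra of `B` (its suprema of small subsets computed in `B`
and lying in `C`) in which every antichain has size at most `κ`.  If `E` is an
ultrafilter on `B` such that every maximal antichain `A` of `C` has a subset `A'` of
size `< κ` with `⋁A' ∈ E`, then every `t ∈ B^(ω)` is `E`-equivalent to some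
`s ∈ C^(ω)`; consequently `|ω^B/E| ≤ |C| ^ ℵ₀`. -/
theorem card_boolean_ultrapower_le {B : Type u} [BooleanAlgebra B] [SupSet B]
    (hB : ∀ S : Set B, S.Countable → IsLUB S (sSup S))
    (κ : Cardinal.{u}) (hreg : κ.IsRegular) (hunc : Cardinal.aleph0 < κ)
    (C : Set B) (hCsub : IsSubalgebraSet C)
    (hkc : ∀ S : Set B, S ⊆ C → Cardinal.mk S < κ → IsLUB S (sSup S) ∧ sSup S ∈ C)
    (hdense : ∀ b : B, b ≠ ⊥ → ∃ c ∈ C, c ≠ ⊥ ∧ c ≤ b)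
    (hanti : ∀ A : Set B, A ⊆ C → (A.Pairwise fun x y => x ⊓ y = ⊥) →
      Cardinal.mk A ≤ κ)
    (E : Set B) (hE : IsUltrafilterOn E)
    (hEsmall : ∀ A : Set B, IsMaxAntichainIn C A →
      ∃ A' : Set B, A' ⊆ A ∧ Cardinal.mk A' < κ ∧ sSup A' ∈ E) :
    (∀ t : ℕ → B, IsPartitionSeq t →
      ∃ s : ℕ → B, IsPartitionSeq s ∧ (∀ n, s n ∈ C) ∧ eqBB t s ∈ E) ∧
      Cardinal.mk
          (Quot fun s t : {u : ℕ → B // IsPartitionSeq u} => eqBB s.1 t.1 ∈ E) ≤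
        Cardinal.mk C ^ Cardinal.aleph0 := by
  have represent : ∀ t : ℕ → B, IsPartitionSeq t →
      ∃ s : ℕ → B, IsPartitionSeq s ∧ (∀ n, s n ∈ C) ∧ eqBB t s ∈ E := by
    intro t ht
    obtain ⟨A, hAD, hAmax⟩ := exists_isMaxAntichainIn_subset
      (D := {d ∈ C | ∃ n, d ≤ t n}) (Set.sep_subset _ _) ⟨hCsub.1, 0, bot_le⟩
      fun c _ hc => exists_le_partition_term hB hdense ht hc
    obtain ⟨A', hA'A, hcard, hmem⟩ := hEsmall A hAmax
    obtain ⟨s, hs, hsC, hle⟩ := exists_partition_eqBB_ge hB hCsub (A := A')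
      (fun S hS => hkc S (fun a ha => (hAD (hA'A (hS ha))).1)
        ((Cardinal.mk_le_mk_of_subset hS).trans_lt hcard))
      ht fun a ha => (hAD (hA'A ha)).2
    exact ⟨s, hs, hsC, hE.2.1 _ hmem _ hle⟩
  refine ⟨represent, ?_⟩
  let S := {s : ℕ → C // IsPartitionSeq fun n => (s n : B)}
  let q : S → Quot fun s t : {u : ℕ → B // IsPartitionSeq u} => eqBB s.1 t.1 ∈ E :=
    fun s => Quot.mk _ ⟨fun n => s.1 n, s.2⟩
  have hq : Function.Surjective q := by
    rintro ⟨t, ht⟩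
    obtain ⟨s, hs, hsC, hts⟩ := represent t ht
    refine ⟨⟨fun n => ⟨s n, hsC n⟩, hs⟩, Eq.symm (Quot.sound ?_)⟩
    exact hts
  calc _ ≤ Cardinal.mk S := Cardinal.mk_le_of_surjective hq
    _ ≤ Cardinal.mk (ℕ → C) := Cardinal.mk_subtype_le _
    _ = Cardinal.mk C ^ Cardinal.aleph0 := by simp
end

section
/- Let B be a complete Boolean algebra which is a subalgebra of a Boolean algebra C, and let I be an ideal of C with I ∩ B = {0}. Then there exists a retraction r : C → B (a Boolean homomorphism restricting to the identity on B) such that r(a) = 0 for every a ∈ I. -/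
/-- An ideal of `C`, given as a set, meeting the range of `f : B → C` only in the image of `⊥`. -/
structure IsAvoidingIdeal {B C : Type*} [BooleanAlgebra B] [BooleanAlgebra C]
    (f : BoundedLatticeHom B C) (J : Set C) : Prop where
  bot_mem : ⊥ ∈ J
  lower : ∀ x ∈ J, ∀ y ≤ x, y ∈ J
  sup_mem : ∀ x ∈ J, ∀ y ∈ J, x ⊔ y ∈ J
  eq_bot : ∀ b, f b ∈ J → b = ⊥

namespace IsAvoidingIdeal

section BooleanAlgebra

variable {B C : Type*} [BooleanAlgebra B] [BooleanAlgebra C] {f : BoundedLatticeHom B C}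
  {I J : Set C}

theorem exists_maximal (hI : IsAvoidingIdeal f I) :
    ∃ J, I ⊆ J ∧ Maximal (IsAvoidingIdeal f) J := by
  refine zorn_subset_nonempty {J | IsAvoidingIdeal f J} ?_ I hI
  rintro c hcI hchain ⟨J₀, hJ₀⟩
  have hc {s : Set C} (hs : s ∈ c) : IsAvoidingIdeal f s := hcI hs
  refine ⟨⋃₀ c, ⟨⟨J₀, hJ₀, (hc hJ₀).bot_mem⟩, ?_, ?_, ?_⟩, fun s hs => Set.subset_sUnion_of_mem hs⟩
  · rintro x ⟨s, hs, hx⟩ y hy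
    exact ⟨s, hs, (hc hs).lower x hx y hy⟩
  · rintro x ⟨s, hs, hx⟩ y ⟨t, ht, hy⟩
    rcases hchain.total hs ht with h | h
    · exact ⟨t, ht, (hc ht).sup_mem x (h hx) y hy⟩
    · exact ⟨s, hs, (hc hs).sup_mem x hx y (h hy)⟩
  · rintro b ⟨s, hs, hb⟩
    exact (hc hs).eq_bot b hb

/-- Modulo a maximal avoiding ideal, the range of `f` is dense. -/
theorem exists_sdiff_mem_of_maximal (hJ : Maximal (IsAvoidingIdeal f) J) {d : C} (hd : d ∉ J) :
    ∃ x, x ≠ ⊥ ∧ f x \ d ∈ J := by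
  by_contra! h
  have hK : IsAvoidingIdeal f {z | z \ d ∈ J} :=
    { bot_mem := by simpa using hJ.prop.bot_mem
      lower := fun x hx y hy => hJ.prop.lower _ hx _ (sdiff_le_sdiff_right hy)
      sup_mem := fun x hx y hy => by
        change (x ⊔ y) \ d ∈ J
        rw [sup_sdiff]
        exact hJ.prop.sup_mem _ hx _ hy
      eq_bot := fun b hb => by_contra fun hne => h b hne hb }
  refine hd (hJ.le_of_ge hK (fun x hx => hJ.prop.lower x hx _ sdiff_le) ?_)
  simpa using hJ.prop.bot_mem

theorem eq_of_symmDiff_mem (hJ : IsAvoidingIdeal f J) {c : C} {x y : B}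
    (hx : symmDiff (f x) c ∈ J) (hy : symmDiff (f y) c ∈ J) : x = y := by
  rw [← symmDiff_eq_bot]
  apply hJ.eq_bot
  rw [map_symmDiff']
  refine hJ.lower _ (hJ.sup_mem _ hx _ hy) _ ?_
  rw [symmDiff_comm (f y) c]
  exact symmDiff_triangle _ _ _

end BooleanAlgebra

variable {B C : Type*} [CompleteBooleanAlgebra B] [BooleanAlgebra C] {f : BoundedLatticeHom B C}
  {J : Set C}

/-- Modulo a maximal avoiding ideal, every element of `C` is in the range of `f`. -/
theorem exists_symmDiff_mem_of_maximal (hJ : Maximal (IsAvoidingIdeal f) J) (c : C) :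
    ∃ b, symmDiff (f b) c ∈ J := by
  have hP := hJ.prop
  set S : Set B := {x | f x \ c ∈ J} with hS
  refine ⟨sSup S, hP.sup_mem _ ?_ _ ?_⟩
  · by_contra hd
    obtain ⟨x, hx, hxJ⟩ := exists_sdiff_mem_of_maximal hJ hd
    rw [sdiff_sdiff_right'] at hxJ
    have hxS : x ≤ sSup S := by
      rw [← sdiff_eq_bot_iff]
      refine hP.eq_bot _ ?_
      rw [map_sdiff']
      exact hP.lower _ hxJ _ le_sup_left
    have hxc : f x ⊓ c ∈ J := hP.lower _ hxJ _ le_sup_right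
    have hdisj : Disjoint (sSup S) x := by
      rw [sSup_disjoint_iff]
      intro y hy
      rw [disjoint_iff]
      refine hP.eq_bot _ (hP.lower _ (hP.sup_mem _ hy _ hxc) _ ?_)
      calc f (y ⊓ x) = (f y ⊓ f x) \ c ⊔ (f y ⊓ f x) ⊓ c := by rw [map_inf, sup_comm, sup_inf_sdiff]
        _ ≤ f y \ c ⊔ f x ⊓ c :=
          sup_le_sup (sdiff_le_sdiff_right inf_le_left) (inf_le_inf_right _ inf_le_right)
    exact hx (hdisj.symm.eq_bot_of_le hxS)
  · by_contra hd
    obtain ⟨x, hx, hxJ⟩ := exists_sdiff_mem_of_maximal hJ hd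
    rw [sdiff_sdiff_right'] at hxJ
    have hxS : x ≤ sSup S := le_sSup (hP.lower _ hxJ _ le_sup_left)
    refine hx (hP.eq_bot _ (hP.lower _ hxJ _ ?_))
    exact le_sup_of_le_right (le_inf le_rfl (OrderHomClass.mono f hxS))

end IsAvoidingIdeal


/-- (Sikorski)  Let `B` be a complete Boolean algebra which is a subalgebra of a
Boolean algebra `C` (via a Boolean embedding `f : B → C`), and let `I` be an ideal
of `C` with `I ∩ B = {0}`.  Then there is a retraction `r : C → B`, i.e. a Boolean
homomorphism with `r ∘ f = id`, such that `r a = ⊥` for every `a ∈ I`. -/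
theorem sikorski_retraction {B : Type u} [CompleteBooleanAlgebra B]
    {C : Type v} [BooleanAlgebra C]
    (f : B → C) (hfinj : Function.Injective f)
    (hfsup : ∀ x y : B, f (x ⊔ y) = f x ⊔ f y)
    (hfcompl : ∀ x : B, f xᶜ = (f x)ᶜ)
    (I : Set C)
    (hIbot : ⊥ ∈ I)
    (hIdown : ∀ x ∈ I, ∀ y : C, y ≤ x → y ∈ I)
    (hIsup : ∀ x ∈ I, ∀ y ∈ I, x ⊔ y ∈ I)
    (hIB : ∀ b : B, f b ∈ I → b = ⊥) :
    ∃ r : C → B,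
      (∀ x y : C, r (x ⊔ y) = r x ⊔ r y) ∧
      (∀ x : C, r xᶜ = (r x)ᶜ) ∧
      (∀ b : B, r (f b) = b) ∧
      ∀ a ∈ I, r a = ⊥ := by
  have hinf (x y : B) : f (x ⊓ y) = f x ⊓ f y := by
    rw [← compl_inj_iff, ← hfcompl, compl_inf, hfsup, hfcompl, hfcompl, compl_inf]
  have hbot : f ⊥ = ⊥ := by
    rw [← inf_compl_self (⊥ : B), hinf, hfcompl, inf_compl_self]
  let F : BoundedLatticeHom B C :=
    { toFun := f
      map_sup' := hfsup
      map_inf' := hinf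
      map_top' := by rw [← compl_bot, hfcompl, hbot, compl_bot]
      map_bot' := hbot }
  have hI : IsAvoidingIdeal F I := ⟨hIbot, hIdown, hIsup, hIB⟩
  obtain ⟨J, hIJ, hJ⟩ := hI.exists_maximal
  have hP := hJ.prop
  choose r hr using IsAvoidingIdeal.exists_symmDiff_mem_of_maximal hJ
  refine ⟨r, fun x y => hP.eq_of_symmDiff_mem (hr _) ?_, fun x => hP.eq_of_symmDiff_mem (hr _) ?_,
    fun b => hP.eq_of_symmDiff_mem (hr _) ?_, fun a ha => hP.eq_of_symmDiff_mem (hr _) ?_⟩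
  · rw [map_sup]
    refine hP.lower _ (hP.sup_mem _ (hr x) _ (hr y)) _ ?_
    rw [symmDiff, symmDiff, symmDiff, sup_sup_sup_comm, sup_sdiff, sup_sdiff]
    gcongr <;> simp
  · rw [map_compl', compl_symmDiff_compl]
    exact hr x
  · change symmDiff (f b) (f b) ∈ J
    rw [symmDiff_self]
    exact hP.bot_mem
  · rw [map_bot, bot_symmDiff]
    exact hIJ ha
end

section
/- Let B and C be countably complete Boolean algebras with B ⊆ C (suprema of countable subsets of B computed in B coincide with those computed in C). Let E be an ultrafilter on B and E' an ultrafilter on C with E ⊆ E'. Then the map i : ω^B/E → ω^C/E' defined by i(t_E) = t_{E'} for t ∈ B^(ω) ⊆ C^(ω) is well defined, injective, order preserving, and fixes every standard natural number; indeed it is an elementary embedding with respect to the first-order language of linear orders. -/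
open FirstOrder

/-- `[[s < t]] = ⋁_{m<n} (s m ⊓ t n)`. -/
def ltBB {B : Type*} [BooleanAlgebra B] [SupSet B] (s t : ℕ → B) : B :=
  sSup {x | ∃ m n : ℕ, m < n ∧ x = s m ⊓ t n}

/-- The Boolean ultrapower `ω^B/E`: classes of elements of `B^(ω)` where `s ∼ t` iff
`[[s = t]] ∈ E`. -/
def BUP {B : Type*} [BooleanAlgebra B] [SupSet B] (E : Set B) : Type _ :=
  Quot fun s t : {u : ℕ → B // IsPartitionSeq u} => eqBB s.1 t.1 ∈ E

/-- The (linear, when `E` is an ultrafilter) order of the Boolean ultrapower: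
`s_E ≤ t_E` iff `[[s < t]] ∈ E` or `[[s = t]] ∈ E`. -/
instance BUP.instLE {B : Type*} [BooleanAlgebra B] [SupSet B] (E : Set B) :
    LE (BUP E) :=
  ⟨fun x y => ∃ s t : {u : ℕ → B // IsPartitionSeq u},
    x = Quot.mk _ s ∧ y = Quot.mk _ t ∧ (ltBB s.1 t.1 ∈ E ∨ eqBB s.1 t.1 ∈ E)⟩

/-- The Boolean ultrapower as a structure in the first-order language of
linear orders. -/
noncomputable instance BUP.instOrderStructure {B : Type*} [BooleanAlgebra B]
    [SupSet B] (E : Set B) : Language.order.Structure (BUP E) :=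
  Language.orderStructure _

section BooleanUltrapower

variable {B : Type*} [BooleanAlgebra B] [SupSet B]

/-- The Boolean value `⋁_{m ∈ A} p m` of a set `A` of natural numbers. -/
def setBV (p : ℕ → B) (A : Set ℕ) : B := sSup (p '' A)

/-- The sequence of Boolean values of the fibres of `g`. -/
def pushSeq (p : ℕ → B) (g : ℕ → ℕ) (n : ℕ) : B := setBV p (g ⁻¹' {n})

variable (hB : ∀ S : Set B, S.Countable → IsLUB S (sSup S))

include hB

theorem isLUB_setBV (p : ℕ → B) (A : Set ℕ) : IsLUB (p '' A) (setBV p A) :=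
  hB _ (A.to_countable.image p)

theorem setBV_le_iff {p : ℕ → B} {A : Set ℕ} {c : B} :
    setBV p A ≤ c ↔ ∀ m ∈ A, p m ≤ c := by
  rw [isLUB_le_iff (isLUB_setBV hB p A)]
  simp [mem_upperBounds]

theorem le_setBV (p : ℕ → B) {A : Set ℕ} {m : ℕ} (hm : m ∈ A) : p m ≤ setBV p A :=
  (setBV_le_iff hB).1 le_rfl m hm

theorem setBV_mono (p : ℕ → B) {A A' : Set ℕ} (h : A ⊆ A') : setBV p A ≤ setBV p A' :=
  (setBV_le_iff hB).2 fun _ hm => le_setBV hB p (h hm)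

theorem setBV_empty (p : ℕ → B) : setBV p ∅ = ⊥ :=
  le_bot_iff.1 ((setBV_le_iff hB).2 fun _ hm => hm.elim)

theorem setBV_inter {p : ℕ → B} (hp : IsPartitionSeq p) (A A' : Set ℕ) :
    setBV p (A ∩ A') = setBV p A ⊓ setBV p A' := by
  refine le_antisymm (le_inf (setBV_mono hB p Set.inter_subset_left)
    (setBV_mono hB p Set.inter_subset_right)) ?_
  rw [← le_himp_iff, setBV_le_iff hB]
  intro m hm
  rw [le_himp_iff, inf_comm, ← le_himp_iff, setBV_le_iff hB]
  intro m' hm'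
  rw [le_himp_iff]
  by_cases h : m' = m
  · subst h
    exact inf_le_left.trans (le_setBV hB p ⟨hm, hm'⟩)
  · exact (hp.1 m' m h).le.trans bot_le

omit hB in
theorem setBV_univ {p : ℕ → B} (hp : IsPartitionSeq p) : setBV p Set.univ = ⊤ := by
  rw [← hp.2, setBV, Set.image_univ, iSup]

theorem setBV_iUnion {ι : Type*} [Countable ι] (p : ℕ → B) (A : ι → Set ℕ) :
    sSup (Set.range fun i => setBV p (A i)) = setBV p (⋃ i, A i) := by
  refine (hB _ (Set.countable_range _)).unique ⟨?_, ?_⟩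
  · rintro _ ⟨i, rfl⟩
    exact setBV_mono hB p (Set.subset_iUnion A i)
  · intro c hc
    rw [setBV_le_iff hB]
    intro m hm
    obtain ⟨i, hi⟩ := Set.mem_iUnion.1 hm
    exact (le_setBV hB p hi).trans (hc ⟨i, rfl⟩)

theorem setBV_compl {p : ℕ → B} (hp : IsPartitionSeq p) (A : Set ℕ) :
    setBV p Aᶜ = (setBV p A)ᶜ := by
  refine (IsCompl.compl_eq (IsCompl.of_eq ?_ ?_)).symm
  · rw [← setBV_inter hB hp, Set.inter_compl_self, setBV_empty hB]
  · rw [← top_le_iff, ← setBV_univ hp, setBV_le_iff hB]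
    intro m _
    by_cases hm : m ∈ A
    · exact (le_setBV hB p hm).trans le_sup_left
    · exact (le_setBV hB p (A := Aᶜ) hm).trans le_sup_right

theorem setBV_pushSeq (p : ℕ → B) (g : ℕ → ℕ) (A : Set ℕ) :
    setBV (pushSeq p g) A = setBV p (g ⁻¹' A) := by
  have h := setBV_iUnion hB p (fun n : A => g ⁻¹' {(n : ℕ)})
  have h1 : (⋃ n : A, g ⁻¹' {(n : ℕ)}) = g ⁻¹' A := by
    ext m; simp
  rw [← h1, ← h, setBV, Set.image_eq_range]
  rfl

theorem IsPartitionSeq.pushSeq {p : ℕ → B} (hp : IsPartitionSeq p) (g : ℕ → ℕ) :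
    IsPartitionSeq (pushSeq p g) := by
  refine ⟨fun m n hmn => ?_, ?_⟩
  · have h : g ⁻¹' {m} ∩ g ⁻¹' {n} = ∅ := by
      ext k
      simp only [Set.mem_inter_iff, Set.mem_preimage, Set.mem_singleton_iff,
        Set.mem_empty_iff_false, iff_false]
      rintro ⟨rfl, h⟩
      exact hmn h
    rw [_root_.pushSeq, _root_.pushSeq, ← setBV_inter hB hp, h, setBV_empty hB]
  · have h := setBV_pushSeq hB p g Set.univ
    rwa [Set.preimage_univ, setBV_univ hp, setBV, Set.image_univ] at h

theorem pushSeq_pushSeq (p : ℕ → B) (g h : ℕ → ℕ) :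
    pushSeq (pushSeq p g) h = pushSeq p (h ∘ g) :=
  funext fun _ => setBV_pushSeq hB p g _

theorem eqBB_pushSeq {p : ℕ → B} (hp : IsPartitionSeq p) (g h : ℕ → ℕ) :
    eqBB (pushSeq p g) (pushSeq p h) = setBV p {m | g m = h m} := by
  have h1 : (⋃ n : ℕ, g ⁻¹' {n} ∩ h ⁻¹' {n}) = {m | g m = h m} := by
    ext m; simp [eq_comm]
  rw [← h1, ← setBV_iUnion hB, eqBB]
  congr 1
  ext x
  simp [pushSeq, setBV_inter hB hp, eq_comm]

theorem ltBB_pushSeq {p : ℕ → B} (hp : IsPartitionSeq p) (g h : ℕ → ℕ) :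
    ltBB (pushSeq p g) (pushSeq p h) = setBV p {m | g m < h m} := by
  have h1 : (⋃ a : {a : ℕ × ℕ // a.1 < a.2}, g ⁻¹' {a.1.1} ∩ h ⁻¹' {a.1.2}) =
      {m | g m < h m} := by
    ext m; simp
  rw [← h1, ← setBV_iUnion hB, ltBB]
  congr 1
  ext x
  simp [pushSeq, setBV_inter hB hp, eq_comm]

theorem exists_common_refinement {s t : ℕ → B} (hs : IsPartitionSeq s) (ht : IsPartitionSeq t) :
    ∃ p : ℕ → B, IsPartitionSeq p ∧ ∃ g h : ℕ → ℕ, s = pushSeq p g ∧ t = pushSeq p h := by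
  set p : ℕ → B := fun k => s k.unpair.1 ⊓ t k.unpair.2 with hpdef
  have hpair : ∀ m n, p (Nat.pair m n) = s m ⊓ t n := fun m n => by simp [hpdef]
  have htop : ∀ {u : ℕ → B}, IsPartitionSeq u → ∀ {b c : B}, (∀ n, b ⊓ u n ≤ c) → b ≤ c := by
    intro u hu b c h
    have h1 : setBV u Set.univ ≤ b ⇨ c := by
      rw [setBV_le_iff hB]
      intro n _
      rw [le_himp_iff, inf_comm]
      exact h n
    rw [setBV_univ hu, le_himp_iff, top_inf_eq] at h1
    exact h1
  refine ⟨p, ⟨fun a b hab => ?_, ?_⟩, fun k => k.unpair.1, fun k => k.unpair.2, ?_, ?_⟩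
  · have h : a.unpair.1 ≠ b.unpair.1 ∨ a.unpair.2 ≠ b.unpair.2 := by
      by_contra! h
      apply hab
      rw [← Nat.pair_unpair a, ← Nat.pair_unpair b, h.1, h.2]
    simp only [hpdef]
    rw [inf_inf_inf_comm]
    rcases h with h | h
    · rw [hs.1 _ _ h, bot_inf_eq]
    · rw [ht.1 _ _ h, inf_bot_eq]
  · rw [iSup, ← Set.image_univ, ← top_le_iff]
    change ⊤ ≤ setBV p Set.univ
    refine htop hs fun m => htop ht fun n => ?_
    rw [top_inf_eq, ← hpair]
    exact le_setBV hB p (Set.mem_univ _)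
  · ext n
    refine le_antisymm (htop ht fun m => ?_) ((setBV_le_iff hB).2 ?_)
    · rw [← hpair]
      exact le_setBV hB p (by simp)
    · rintro m rfl
      exact inf_le_left
  · ext n
    refine le_antisymm (htop hs fun m => ?_) ((setBV_le_iff hB).2 ?_)
    · rw [inf_comm, ← hpair]
      exact le_setBV hB p (by simp)
    · rintro m rfl
      exact inf_le_right

omit [SupSet B] hB in
theorem IsUltrafilterOn.compl_mem_iff {E : Set B} (hE : IsUltrafilterOn E) (b : B) :
    bᶜ ∈ E ↔ b ∉ E := by
  refine ⟨fun h h' => hE.1 ?_, (hE.2.2.2 b).resolve_left⟩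
  simpa using hE.2.2.1 _ h' _ h

/-- The ultrafilter on `ℕ` of the sets whose Boolean value lies in `E`. -/
def bvUltrafilter {E : Set B} (hE : IsUltrafilterOn E) (p : {u : ℕ → B // IsPartitionSeq u}) :
    Ultrafilter ℕ :=
  Ultrafilter.ofComplNotMemIff
    { sets := {A | setBV p.1 A ∈ E}
      univ_sets := by
        have h := (hE.compl_mem_iff ⊥).2 hE.1
        rw [compl_bot, ← setBV_univ p.2] at h
        exact h
      sets_of_superset := fun h hAA' => hE.2.1 _ h _ (setBV_mono hB _ hAA')
      inter_sets := fun h h' => by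
        have := hE.2.2.1 _ h _ h'
        rwa [← setBV_inter hB p.2] at this }
    fun A => by
      change setBV p.1 Aᶜ ∉ E ↔ setBV p.1 A ∈ E
      rw [setBV_compl hB p.2, hE.compl_mem_iff, not_not]

/-- `pushSeq` as an operation on `B^(ω)`. -/
def pushPart (p : {u : ℕ → B // IsPartitionSeq u}) (g : ℕ → ℕ) :
    {u : ℕ → B // IsPartitionSeq u} :=
  ⟨pushSeq p.1 g, p.2.pushSeq hB g⟩

theorem pushPart_pushPart (p : {u : ℕ → B // IsPartitionSeq u}) (g h : ℕ → ℕ) :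
    pushPart hB (pushPart hB p g) h = pushPart hB p (h ∘ g) :=
  Subtype.ext (pushSeq_pushSeq hB p.1 g h)

theorem exists_eq_pushPart (s t : {u : ℕ → B // IsPartitionSeq u}) :
    ∃ p, ∃ g h : ℕ → ℕ, s = pushPart hB p g ∧ t = pushPart hB p h := by
  obtain ⟨p, hp, g, h, hs, ht⟩ := exists_common_refinement hB s.2 t.2
  exact ⟨⟨p, hp⟩, g, h, Subtype.ext hs, Subtype.ext ht⟩

variable {E : Set B} (hE : IsUltrafilterOn E)

theorem eventually_bvUltrafilter_pushPart (p : {u : ℕ → B // IsPartitionSeq u}) (g : ℕ → ℕ)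
    (P : ℕ → Prop) :
    (∀ᶠ m in bvUltrafilter hB hE (pushPart hB p g), P m) ↔
      ∀ᶠ m in bvUltrafilter hB hE p, P (g m) := by
  change setBV (pushSeq p.1 g) {m | P m} ∈ E ↔ setBV p.1 {m | P (g m)} ∈ E
  rw [setBV_pushSeq hB]
  rfl

theorem eqBB_pushPart_mem_iff (p : {u : ℕ → B // IsPartitionSeq u}) (g h : ℕ → ℕ) :
    eqBB (pushPart hB p g).1 (pushPart hB p h).1 ∈ E ↔
      ∀ᶠ m in bvUltrafilter hB hE p, g m = h m := by
  change eqBB (pushSeq p.1 g) (pushSeq p.1 h) ∈ E ↔ setBV p.1 {m | g m = h m} ∈ E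
  rw [eqBB_pushSeq hB p.2]

theorem ltBB_pushPart_mem_iff (p : {u : ℕ → B // IsPartitionSeq u}) (g h : ℕ → ℕ) :
    ltBB (pushPart hB p g).1 (pushPart hB p h).1 ∈ E ↔
      ∀ᶠ m in bvUltrafilter hB hE p, g m < h m := by
  change ltBB (pushSeq p.1 g) (pushSeq p.1 h) ∈ E ↔ setBV p.1 {m | g m < h m} ∈ E
  rw [ltBB_pushSeq hB p.2]

include hE in
theorem equivalence_eqBB_mem : Equivalence fun s t : {u : ℕ → B // IsPartitionSeq u} =>
    eqBB s.1 t.1 ∈ E := by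
  refine ⟨fun s => ?_, fun {s t} h => ?_, fun {s t u} h h' => ?_⟩
  · obtain ⟨p, g, -, rfl, -⟩ := exists_eq_pushPart hB s s
    rw [eqBB_pushPart_mem_iff hB hE]
    exact Filter.Eventually.of_forall fun _ => rfl
  · simpa only [eqBB, inf_comm] using h
  · obtain ⟨q, a, b, rfl, rfl⟩ := exists_eq_pushPart hB s t
    obtain ⟨p, c, d, rfl, rfl⟩ := exists_eq_pushPart hB q u
    simp only [pushPart_pushPart, eqBB_pushPart_mem_iff hB hE] at h h' ⊢
    filter_upwards [h, h'] with m h1 h2 using h1.trans h2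

include hE in
theorem BUP.mk_eq_mk_iff (s t : {u : ℕ → B // IsPartitionSeq u}) :
    (Quot.mk _ s : BUP E) = Quot.mk _ t ↔ eqBB s.1 t.1 ∈ E :=
  (equivalence_eqBB_mem hB hE).quot_mk_eq_iff s t

/-- The class of `pushPart hB p g` in the Boolean ultrapower. -/
def BUP.push (E : Set B) (p : {u : ℕ → B // IsPartitionSeq u}) (g : ℕ → ℕ) : BUP E :=
  Quot.mk _ (pushPart hB p g)

theorem BUP.push_eq_push_iff (p : {u : ℕ → B // IsPartitionSeq u}) (g h : ℕ → ℕ) :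
    BUP.push hB E p g = BUP.push hB E p h ↔ ∀ᶠ m in bvUltrafilter hB hE p, g m = h m :=
  (BUP.mk_eq_mk_iff hB hE _ _).trans (eqBB_pushPart_mem_iff hB hE p g h)

theorem BUP.push_pushPart (p : {u : ℕ → B // IsPartitionSeq u}) (g h : ℕ → ℕ) :
    BUP.push hB E (pushPart hB p g) h = BUP.push hB E p (h ∘ g) :=
  congrArg (Quot.mk _) (pushPart_pushPart hB p g h)

theorem BUP.exists_eq_push (q : {u : ℕ → B // IsPartitionSeq u}) (x : BUP E) :
    ∃ p, ∃ g h : ℕ → ℕ, q = pushPart hB p g ∧ x = BUP.push hB E p h := by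
  induction x using Quot.ind with
  | mk s =>
    obtain ⟨p, g, h, rfl, rfl⟩ := exists_eq_pushPart hB q s
    exact ⟨p, g, h, rfl, rfl⟩

theorem BUP.push_le_push_iff (p : {u : ℕ → B // IsPartitionSeq u}) (g h : ℕ → ℕ) :
    BUP.push hB E p g ≤ BUP.push hB E p h ↔ ∀ᶠ m in bvUltrafilter hB hE p, g m ≤ h m := by
  constructor
  · rintro ⟨s, t, hs, ht, hst⟩
    obtain ⟨r, a, b, rfl, rfl⟩ := exists_eq_pushPart hB s t
    obtain ⟨q, c, d, rfl, rfl⟩ := exists_eq_pushPart hB p r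
    have hs' : BUP.push hB E (pushPart hB q c) g = BUP.push hB E (pushPart hB q d) a := hs
    have ht' : BUP.push hB E (pushPart hB q c) h = BUP.push hB E (pushPart hB q d) b := ht
    rw [eventually_bvUltrafilter_pushPart]
    simp only [BUP.push_pushPart, BUP.push_eq_push_iff hB hE] at hs' ht'
    simp only [pushPart_pushPart, eqBB_pushPart_mem_iff hB hE, ltBB_pushPart_mem_iff hB hE,
      ← Ultrafilter.eventually_or, ← le_iff_lt_or_eq] at hst
    filter_upwards [hs', ht', hst] with m h1 h2 h3
    simp only [Function.comp_apply] at h1 h2 h3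
    omega
  · intro H
    refine ⟨_, _, rfl, rfl, ?_⟩
    simpa only [eqBB_pushPart_mem_iff hB hE, ltBB_pushPart_mem_iff hB hE,
      ← Ultrafilter.eventually_or, ← le_iff_lt_or_eq] using H

theorem BUP.exists_forall_eq_push {k : ℕ} (v : Fin k → BUP E) :
    ∃ p, ∃ g : Fin k → ℕ → ℕ, ∀ i, v i = BUP.push hB E p (g i) := by
  induction k with
  | zero =>
    have hp : IsPartitionSeq (fun n : ℕ => if n = 0 then (⊤ : B) else ⊥) := by
      refine ⟨fun m n hmn => ?_, (hB _ (Set.countable_range _)).unique ⟨fun _ _ => le_top, ?_⟩⟩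
      · by_cases hm : m = 0
        · have hn : n ≠ 0 := fun hn => hmn (hm.trans hn.symm)
          simp [hn]
        · simp [hm]
      · exact fun c hc => hc ⟨0, by simp⟩
    exact ⟨⟨_, hp⟩, fun i => i.elim0, fun i => i.elim0⟩
  | succ k ih =>
    obtain ⟨q, g, hg⟩ := ih (fun i => v i.castSucc)
    obtain ⟨p, a, b, rfl, hb⟩ := BUP.exists_eq_push hB q (v (Fin.last k))
    refine ⟨p, Fin.snoc (fun i => g i ∘ a) b, fun i => ?_⟩
    induction i using Fin.lastCases with
    | last => simpa using hb
    | cast i => simpa [BUP.push_pushPart] using hg i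

/-- Łoś's theorem for Boolean ultrapowers of the natural order. -/
theorem BUP.realize_push_iff {α : Type*} {n : ℕ} (φ : Language.order.BoundedFormula α n)
    (p : {u : ℕ → B // IsPartitionSeq u}) (g : α → ℕ → ℕ) (h : Fin n → ℕ → ℕ) :
    φ.Realize (fun i => BUP.push hB E p (g i)) (fun j => BUP.push hB E p (h j)) ↔
      ∀ᶠ m in bvUltrafilter hB hE p,
        letI := Language.orderStructure ℕ
        φ.Realize (fun i => g i m) (fun j => h j m) := by
  let := Language.orderStructure ℕ
  have hterm : ∀ {n : ℕ} (t : Language.order.Term (α ⊕ Fin n)), ∃ a, t = Language.Term.var a := by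
    intro n t
    cases t with
    | var a => exact ⟨a, rfl⟩
    | func f _ => exact isEmptyElim f
  have hvar : ∀ {n : ℕ} (p : {u : ℕ → B // IsPartitionSeq u}) (g : α → ℕ → ℕ)
      (h : Fin n → ℕ → ℕ) (a : α ⊕ Fin n),
      Sum.elim (fun i => BUP.push hB E p (g i)) (fun j => BUP.push hB E p (h j)) a =
        BUP.push hB E p fun m => Sum.elim (fun i => g i m) (fun j => h j m) a := by
    rintro n p g h (i | j) <;> rfl
  induction φ generalizing p g with
  | falsum => simpa [Language.BoundedFormula.Realize] using
      (bvUltrafilter hB hE p).neBot.ne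
  | equal t₁ t₂ =>
    obtain ⟨a, rfl⟩ := hterm t₁
    obtain ⟨b, rfl⟩ := hterm t₂
    simp only [Language.BoundedFormula.Realize, Language.Term.realize_var, hvar,
      BUP.push_eq_push_iff hB hE]
  | rel R ts =>
    cases R
    obtain ⟨a, ha⟩ := hterm (ts 0)
    obtain ⟨b, hb⟩ := hterm (ts 1)
    change (ts 0).realize _ ≤ (ts 1).realize _ ↔
      ∀ᶠ m in _, (ts 0).realize _ ≤ (ts 1).realize _
    simp only [ha, hb, Language.Term.realize_var, hvar, BUP.push_le_push_iff hB hE]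
  | imp φ ψ ihφ ihψ =>
    simp only [Language.BoundedFormula.realize_imp, Ultrafilter.eventually_imp, ihφ, ihψ]
  | all φ ih =>
    have hsnoc : ∀ {n : ℕ} (p : {u : ℕ → B // IsPartitionSeq u}) (h : Fin n → ℕ → ℕ)
        (w : ℕ → ℕ), (Fin.snoc (fun j => BUP.push hB E p (h j)) (BUP.push hB E p w) :
          Fin (n + 1) → BUP E) =
        fun j => BUP.push hB E p ((Fin.snoc h w : Fin (n + 1) → ℕ → ℕ) j) := by
      intro n p h w
      ext j
      induction j using Fin.lastCases <;> simp
    have hsnoc' : ∀ {n : ℕ} (h : Fin n → ℕ → ℕ) (w : ℕ → ℕ) (m : ℕ),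
        (fun j => (Fin.snoc h w : Fin (n + 1) → ℕ → ℕ) j m) =
          Fin.snoc (fun j => h j m) (w m) := by
      intro n h w m
      ext j
      induction j using Fin.lastCases <;> simp
    simp only [Language.BoundedFormula.realize_all]
    constructor
    · intro H
      by_contra hcon
      rw [← Ultrafilter.eventually_not] at hcon
      push Not at hcon
      have hw : ∀ m, ∃ y : ℕ, (∃ x : ℕ, ¬ φ.Realize (fun i => g i m)
          (Fin.snoc (fun j => h j m) x)) →
          ¬ φ.Realize (fun i => g i m) (Fin.snoc (fun j => h j m) y) := by
        intro m
        by_cases hx : ∃ x : ℕ, ¬ φ.Realize (fun i => g i m) (Fin.snoc (fun j => h j m) x)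
        · exact ⟨hx.choose, fun _ => hx.choose_spec⟩
        · exact ⟨0, fun hx' => absurd hx' hx⟩
      choose w hw using hw
      have H1 := H (BUP.push hB E p w)
      rw [hsnoc] at H1
      obtain ⟨m, hm1, hm2⟩ := (((ih p g (Fin.snoc h w)).1 H1).and hcon).exists
      rw [hsnoc'] at hm1
      exact hw m hm2 hm1
    · intro H x
      obtain ⟨q, a, b, rfl, rfl⟩ := BUP.exists_eq_push hB p x
      rw [eventually_bvUltrafilter_pushPart] at H
      simp only [BUP.push_pushPart]
      rw [hsnoc]
      refine (ih q _ _).2 ?_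
      filter_upwards [H] with m hm
      rw [hsnoc']
      exact hm (b m)

end BooleanUltrapower

/-- Let `B ⊆ C` be countably complete Boolean algebras (the inclusion `f : B → C`
preserving the Boolean operations and countable suprema), `E` an ultrafilter on `B`
and `E'` an ultrafilter on `C` with `E ⊆ E'`.  Then the map
`i : ω^B/E → ω^C/E'`, `t_E ↦ t_{E'}`, is well defined (it sends the class of `s` to
the class of `f ∘ s`), injective, order preserving, and fixes every standard natural
number; indeed it is elementary for all first-order formulas in the language of
linear orders. -/
theorem boolean_ultrapower_elementary_embedding
    {B : Type u} [BooleanAlgebra B] [SupSet B]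
    (hB : ∀ S : Set B, S.Countable → IsLUB S (sSup S))
    {C : Type v} [BooleanAlgebra C] [SupSet C]
    (hC : ∀ S : Set C, S.Countable → IsLUB S (sSup S))
    (f : B → C) (hfinj : Function.Injective f)
    (hfsup : ∀ x y : B, f (x ⊔ y) = f x ⊔ f y)
    (hfcompl : ∀ x : B, f xᶜ = (f x)ᶜ)
    (hfSup : ∀ S : Set B, S.Countable → f (sSup S) = sSup (f '' S))
    (E : Set B) (hE : IsUltrafilterOn E)
    (E' : Set C) (hE' : IsUltrafilterOn E')
    (hEE' : ∀ x ∈ E, f x ∈ E') :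
    ∃ i : BUP E → BUP E',
      -- i is well defined: it maps the class of s to the class of f ∘ s
      (∀ (s : {u : ℕ → B // IsPartitionSeq u}) (s' : {u : ℕ → C // IsPartitionSeq u}),
        (∀ n, s'.1 n = f (s.1 n)) → i (Quot.mk _ s) = Quot.mk _ s') ∧
      -- i is injective
      Function.Injective i ∧
      -- i preserves the order
      (∀ x y : BUP E, x ≤ y ↔ i x ≤ i y) ∧
      -- i fixes every standard natural number
      (∀ (n : ℕ) (s : {u : ℕ → B // IsPartitionSeq u})
          (s' : {u : ℕ → C // IsPartitionSeq u}),
        s.1 = (fun m => if m = n then ⊤ else ⊥) →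
        s'.1 = (fun m => if m = n then ⊤ else ⊥) →
        i (Quot.mk _ s) = Quot.mk _ s') ∧
      -- i is an elementary embedding for the language of linear orders
      (∀ (k : ℕ) (φ : Language.order.Formula (Fin k)) (v : Fin k → BUP E),
        φ.Realize v ↔ φ.Realize (i ∘ v)) := by
  have hftop : f ⊤ = ⊤ := by
    rw [← sup_compl_eq_top (x := (⊤ : B)), hfsup, hfcompl, sup_compl_eq_top]
  have hfbot : f ⊥ = ⊥ := by
    rw [← compl_top, hfcompl, hftop, compl_top]
  have hfinf : ∀ x y : B, f (x ⊓ y) = f x ⊓ f y := fun x y => by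
    rw [← compl_compl (x ⊓ y), compl_inf, hfcompl, hfsup, hfcompl, hfcompl, compl_sup,
      compl_compl, compl_compl]
  have hfBV : ∀ (p : ℕ → B) (A : Set ℕ), f (setBV p A) = setBV (f ∘ p) A := fun p A => by
    rw [setBV, hfSup _ (A.to_countable.image p), setBV, Set.image_comp]
  have hfpart : ∀ {p : ℕ → B}, IsPartitionSeq p → IsPartitionSeq (f ∘ p) := by
    intro p hp
    refine ⟨fun m n hmn => ?_, ?_⟩
    · rw [Function.comp_apply, Function.comp_apply, ← hfinf, hp.1 m n hmn, hfbot]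
    · have h := hfBV p Set.univ
      rw [setBV_univ hp, hftop, setBV, Set.image_univ] at h
      exact h.symm
  let F : {u : ℕ → B // IsPartitionSeq u} → {u : ℕ → C // IsPartitionSeq u} :=
    fun s => ⟨f ∘ s.1, hfpart s.2⟩
  have hFpush : ∀ p g, F (pushPart hB p g) = pushPart hC (F p) g := fun p g =>
    Subtype.ext (funext fun n => hfBV p.1 _)
  have hU : ∀ p, bvUltrafilter hC hE' (F p) = bvUltrafilter hB hE p := fun p =>
    Ultrafilter.coe_le_coe.1 fun A hA => by
      have h := hEE' _ (show setBV p.1 A ∈ E from hA)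
      rw [hfBV] at h
      exact h
  have hFrel : ∀ s t, eqBB s.1 t.1 ∈ E → eqBB (F s).1 (F t).1 ∈ E' := by
    intro s t hst
    obtain ⟨p, g, h, rfl, rfl⟩ := exists_eq_pushPart hB s t
    rw [hFpush, hFpush, eqBB_pushPart_mem_iff hC hE', hU]
    exact (eqBB_pushPart_mem_iff hB hE p g h).1 hst
  let i : BUP E → BUP E' := Quot.map F hFrel
  have hi : ∀ s s', (∀ n, s'.1 n = f (s.1 n)) → i (Quot.mk _ s) = Quot.mk _ s' := by
    intro s s' h
    have : s' = F s := Subtype.ext (funext h)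
    rw [this]
    rfl
  have hipush : ∀ p g, i (BUP.push hB E p g) = BUP.push hC E' (F p) g := fun p g =>
    congrArg (Quot.mk _) (hFpush p g)
  have hpair : ∀ x y : BUP E, ∃ p g h, x = BUP.push hB E p g ∧ y = BUP.push hB E p h := by
    intro x y
    obtain ⟨p, g, hg⟩ := BUP.exists_forall_eq_push hB ![x, y]
    exact ⟨p, g 0, g 1, hg 0, hg 1⟩
  refine ⟨i, hi, ?_, ?_, ?_, ?_⟩
  · intro x y hxy
    obtain ⟨p, g, h, rfl, rfl⟩ := hpair x y
    rw [hipush, hipush, BUP.push_eq_push_iff hC hE', hU] at hxy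
    exact (BUP.push_eq_push_iff hB hE p g h).2 hxy
  · intro x y
    obtain ⟨p, g, h, rfl, rfl⟩ := hpair x y
    rw [hipush, hipush, BUP.push_le_push_iff hC hE', hU, BUP.push_le_push_iff hB hE]
  · intro n s s' hs hs'
    refine hi s s' fun m => ?_
    rw [hs, hs']
    dsimp only
    split_ifs
    · exact hftop.symm
    · exact hfbot.symm
  · intro k φ v
    obtain ⟨p, g, hg⟩ := BUP.exists_forall_eq_push hB v
    obtain rfl : v = fun j => BUP.push hB E p (g j) := funext hg
    have hiv : i ∘ (fun j => BUP.push hB E p (g j)) = fun j => BUP.push hC E' (F p) (g j) :=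
      funext fun j => hipush p (g j)
    have h1 := BUP.realize_push_iff hB hE φ p g (fun j => j.elim0)
    have h2 := BUP.realize_push_iff hC hE' φ (F p) g (fun j => j.elim0)
    rw [hU] at h2
    rw [hiv, Language.Formula.Realize, Language.Formula.Realize,
      Subsingleton.elim (default : Fin 0 → BUP E) fun j => BUP.push hB E p (j.elim0),
      Subsingleton.elim (default : Fin 0 → BUP E') fun j => BUP.push hC E' (F p) (j.elim0)]
    exact h1.trans h2.symm
end

section
/- Let B and C be countably complete Boolean algebras with B ⊆ C, let E be an ultrafilter on B, let r : C → B be a retraction, and let E' = r⁻¹(E) = {c ∈ C : r(c) ∈ E}. Then E' is an ultrafilter on C extending E; the image of ω^B/E under the map t_E ↦ t_{E'} is an initial segment of ω^C/E'; and for every t ∈ C^(ω), the class t_{E'} lies in that image if and only if ⋁_{n∈ω} r(t(n)) ∈ E. -/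
/-- The strict order of the Boolean ultrapower: `s_E < t_E` iff `[[s < t]] ∈ E`. -/
instance BUP.instLT {B : Type*} [BooleanAlgebra B] [SupSet B] (E : Set B) :
    LT (BUP E) :=
  ⟨fun x y => ∃ s t : {u : ℕ → B // IsPartitionSeq u},
    x = Quot.mk _ s ∧ y = Quot.mk _ t ∧ ltBB s.1 t.1 ∈ E⟩

/-- A map between Boolean algebras that preserves joins and complements is a homomorphism. -/
def boundedLatticeHomOfSupCompl {A B : Type*} [BooleanAlgebra A] [BooleanAlgebra B] (g : A → B)
    (hsup : ∀ x y, g (x ⊔ y) = g x ⊔ g y) (hcompl : ∀ x, g xᶜ = (g x)ᶜ) :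
    BoundedLatticeHom A B :=
  have htop : g ⊤ = ⊤ := by
    rw [← sup_compl_eq_top (x := (⊤ : A)), hsup, hcompl, sup_compl_eq_top]
  { toFun := g
    map_sup' := hsup
    map_inf' := fun x y => by
      rw [← compl_compl (x ⊓ y), compl_inf, hcompl, hsup, hcompl, hcompl, compl_sup,
        compl_compl, compl_compl]
    map_top' := htop
    map_bot' := by rw [← compl_top, hcompl, htop, compl_top] }

/-- A meet with a supremum is bounded as soon as all the meets with its members are. -/
theorem IsLUB.inf_le_of_forall {B : Type*} [BooleanAlgebra B] {S : Set B} {c x y : B}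
    (hc : IsLUB S c) (h : ∀ a ∈ S, a ⊓ x ≤ y) : c ⊓ x ≤ y :=
  le_himp_iff.1 (hc.2 fun a ha => le_himp_iff.2 (h a ha))

theorem IsUltrafilterOn.preimage {B C : Type*} [BooleanAlgebra B] [BooleanAlgebra C] {E : Set B}
    (hE : IsUltrafilterOn E) (r : BoundedLatticeHom C B) : IsUltrafilterOn (r ⁻¹' E) := by
  obtain ⟨hbot, hup, hinf, hcompl⟩ := hE
  refine ⟨by simpa using hbot, fun a ha b hab => hup _ ha _ (OrderHomClass.mono r hab),
    fun a ha b hb => ?_, fun b => ?_⟩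
  · simpa using hinf _ ha _ hb
  · simpa using hcompl (r b)

theorem countable_setOf_eq {α : Type*} (g : ℕ → α) : {x | ∃ n, x = g n}.Countable := by
  refine (Set.countable_range g).mono ?_
  rintro _ ⟨n, rfl⟩
  exact ⟨n, rfl⟩

section CountablyComplete

variable {B C : Type*} [BooleanAlgebra B] [SupSet B] [BooleanAlgebra C] [SupSet C]

theorem isLUB_iSup_of_countable (hB : ∀ S : Set B, S.Countable → IsLUB S (sSup S))
    (t : ℕ → B) : IsLUB (Set.range t) (⨆ n, t n) :=
  hB _ (Set.countable_range t)

theorem isLUB_eqBB (hB : ∀ S : Set B, S.Countable → IsLUB S (sSup S)) (s t : ℕ → B) :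
    IsLUB {x | ∃ n : ℕ, x = s n ⊓ t n} (eqBB s t) :=
  hB _ (countable_setOf_eq _)

theorem isLUB_ltBB (hB : ∀ S : Set B, S.Countable → IsLUB S (sSup S)) (s t : ℕ → B) :
    IsLUB {x | ∃ m n : ℕ, m < n ∧ x = s m ⊓ t n} (ltBB s t) := by
  refine hB _ ((Set.countable_range fun p : ℕ × ℕ => s p.1 ⊓ t p.2).mono ?_)
  rintro _ ⟨m, n, _, rfl⟩
  exact ⟨(m, n), rfl⟩

theorem eqBB_comm (s t : ℕ → B) : eqBB s t = eqBB t s := by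
  simp only [eqBB, inf_comm]

theorem eqBB_inf_le (hB : ∀ S : Set B, S.Countable → IsLUB S (sSup S)) {s : ℕ → B}
    (hs : IsPartitionSeq s) (t : ℕ → B) (n : ℕ) : eqBB s t ⊓ s n ≤ t n := by
  refine (isLUB_eqBB hB s t).inf_le_of_forall ?_
  rintro _ ⟨m, rfl⟩
  obtain rfl | hmn := eq_or_ne m n
  · exact inf_le_left.trans inf_le_right
  · rw [inf_right_comm, hs.1 m n hmn, bot_inf_eq]
    exact bot_le

theorem ltBB_inf_le (hB : ∀ S : Set B, S.Countable → IsLUB S (sSup S)) (s : ℕ → B) {t : ℕ → B}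
    (ht : IsPartitionSeq t) (n : ℕ) : ltBB s t ⊓ t n ≤ (Finset.range n).sup s := by
  refine (isLUB_ltBB hB s t).inf_le_of_forall ?_
  rintro _ ⟨m, k, hmk, rfl⟩
  obtain rfl | hkn := eq_or_ne k n
  · exact inf_le_left.trans (inf_le_left.trans (Finset.le_sup (Finset.mem_range.2 hmk)))
  · rw [inf_assoc, ht.1 k n hkn, inf_bot_eq]
    exact bot_le

theorem map_eqBB (f : BoundedLatticeHom B C)
    (hf : ∀ S : Set B, S.Countable → f (sSup S) = sSup (f '' S)) (s t : ℕ → B) :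
    f (eqBB s t) = eqBB (fun n => f (s n)) fun n => f (t n) := by
  rw [eqBB, hf _ (countable_setOf_eq _), eqBB]
  congr 1
  ext x
  constructor
  · rintro ⟨_, ⟨n, rfl⟩, rfl⟩
    exact ⟨n, map_inf f _ _⟩
  · rintro ⟨n, rfl⟩
    exact ⟨_, ⟨n, rfl⟩, map_inf f _ _⟩

theorem IsPartitionSeq.map (f : BoundedLatticeHom B C)
    (hf : ∀ S : Set B, S.Countable → f (sSup S) = sSup (f '' S)) {s : ℕ → B}
    (hs : IsPartitionSeq s) : IsPartitionSeq fun n => f (s n) := by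
  refine ⟨fun m n hmn => by rw [← map_inf, hs.1 m n hmn, map_bot], ?_⟩
  rw [iSup, Set.range_comp' f s, ← hf _ (Set.countable_range s), ← iSup, hs.2, map_top]

/-- Pairwise disjoint elements become a partition when the complement of their supremum is
joined to the first of them. -/
theorem isPartitionSeq_update_zero (hB : ∀ S : Set B, S.Countable → IsLUB S (sSup S))
    {a : ℕ → B} (ha : ∀ m n, m ≠ n → a m ⊓ a n = ⊥) :
    IsPartitionSeq (Function.update a 0 (a 0 ⊔ (⨆ n, a n)ᶜ)) := by
  have hle : ∀ n, a n ≤ ⨆ n, a n := fun n => (isLUB_iSup_of_countable hB a).1 ⟨n, rfl⟩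
  have hdisj : ∀ n, n ≠ 0 → (a 0 ⊔ (⨆ n, a n)ᶜ) ⊓ a n = ⊥ := fun n hn => by
    rw [inf_sup_right, ha 0 n hn.symm, bot_sup_eq]
    exact (disjoint_compl_left.mono_right (hle n)).eq_bot
  constructor
  · intro m n hmn
    rcases eq_or_ne m 0 with rfl | hm
    · rw [Function.update_self, Function.update_of_ne hmn.symm, hdisj n hmn.symm]
    · rcases eq_or_ne n 0 with rfl | hn
      · rw [Function.update_self, Function.update_of_ne hm, inf_comm, hdisj m hm]
      · rw [Function.update_of_ne hm, Function.update_of_ne hn, ha m n hmn]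
  · set s := Function.update a 0 (a 0 ⊔ (⨆ n, a n)ᶜ) with hs
    have hsle : ∀ n, s n ≤ ⨆ n, s n := fun n => (isLUB_iSup_of_countable hB s).1 ⟨n, rfl⟩
    have has : ∀ n, a n ≤ s n := fun n => by
      rcases eq_or_ne n 0 with rfl | hn
      · simp [hs]
      · simp [hs, hn]
    rw [eq_top_iff, ← sup_compl_eq_top (x := ⨆ n, a n)]
    refine sup_le ((isLUB_iSup_of_countable hB a).2 ?_) (le_trans ?_ (hsle 0))
    · rintro _ ⟨n, rfl⟩
      exact (has n).trans (hsle n)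
    · simp [hs]

/-- If `b` and `⨆ n, x n` lie in an ultrafilter, so does any upper bound of the `b ⊓ x n`. -/
theorem IsUltrafilterOn.iSup_mem_of_inf_le (hB : ∀ S : Set B, S.Countable → IsLUB S (sSup S))
    {E : Set B} (hE : IsUltrafilterOn E) {b y : B} {x : ℕ → B} (hb : b ∈ E)
    (hx : (⨆ n, x n) ∈ E) (h : ∀ n, b ⊓ x n ≤ y) : y ∈ E := by
  refine hE.2.1 _ (hE.2.2.1 _ hx _ hb) _
    ((isLUB_iSup_of_countable hB x).inf_le_of_forall ?_)
  rintro _ ⟨n, rfl⟩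
  rw [inf_comm]
  exact h n

variable {E : Set B}

theorem IsUltrafilterOn.iSup_map_mem_of_eqBB_mem
    (hB : ∀ S : Set B, S.Countable → IsLUB S (sSup S))
    (hC : ∀ S : Set C, S.Countable → IsLUB S (sSup S)) (hE : IsUltrafilterOn E)
    (r : BoundedLatticeHom C B) {s t : ℕ → C} (hs : IsPartitionSeq s) (hst : r (eqBB s t) ∈ E)
    (h : (⨆ n, r (s n)) ∈ E) : (⨆ n, r (t n)) ∈ E := by
  refine hE.iSup_mem_of_inf_le hB hst h fun n => ?_
  rw [← map_inf]
  exact (OrderHomClass.mono r (eqBB_inf_le hC hs t n)).trans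
    ((isLUB_iSup_of_countable hB _).1 ⟨n, rfl⟩)

theorem IsUltrafilterOn.iSup_map_mem_of_ltBB_mem
    (hB : ∀ S : Set B, S.Countable → IsLUB S (sSup S))
    (hC : ∀ S : Set C, S.Countable → IsLUB S (sSup S)) (hE : IsUltrafilterOn E)
    (r : BoundedLatticeHom C B) {s t : ℕ → C} (ht : IsPartitionSeq t) (hst : r (ltBB s t) ∈ E)
    (h : (⨆ n, r (t n)) ∈ E) : (⨆ n, r (s n)) ∈ E := by
  refine hE.iSup_mem_of_inf_le hB hst h fun n => ?_
  rw [← map_inf]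
  refine (OrderHomClass.mono r (ltBB_inf_le hC s ht n)).trans ?_
  rw [map_finset_sup]
  exact Finset.sup_le fun m _ => (isLUB_iSup_of_countable hB fun n => r (s n)).1 ⟨m, rfl⟩

theorem IsUltrafilterOn.iSup_map_mem_congr
    (hB : ∀ S : Set B, S.Countable → IsLUB S (sSup S))
    (hC : ∀ S : Set C, S.Countable → IsLUB S (sSup S)) (hE : IsUltrafilterOn E)
    (r : BoundedLatticeHom C B) {s t : {u : ℕ → C // IsPartitionSeq u}}
    (h : (Quot.mk _ s : BUP (r ⁻¹' E)) = Quot.mk _ t) :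
    (⨆ n, r (s.1 n)) ∈ E ↔ (⨆ n, r (t.1 n)) ∈ E := by
  let P : BUP (r ⁻¹' E) → Prop := Quot.lift (fun u => (⨆ n, r (u.1 n)) ∈ E) fun u v huv =>
    propext ⟨hE.iSup_map_mem_of_eqBB_mem hB hC r u.2 huv,
      hE.iSup_map_mem_of_eqBB_mem hB hC r v.2 (by rw [eqBB_comm]; exact huv)⟩
  exact iff_of_eq (congrArg P h)

/-- A sequence `t` for which the values `r (t n)` have a supremum in `E` is equivalent to
the image of a partition of `B`. -/
theorem IsUltrafilterOn.exists_eqBB_map_mem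
    (hB : ∀ S : Set B, S.Countable → IsLUB S (sSup S))
    (hC : ∀ S : Set C, S.Countable → IsLUB S (sSup S)) (hE : IsUltrafilterOn E)
    (f : BoundedLatticeHom B C) (r : BoundedLatticeHom C B) (hrf : ∀ b, r (f b) = b)
    {t : ℕ → C} (ht : IsPartitionSeq t) (h : (⨆ n, r (t n)) ∈ E) :
    ∃ s : ℕ → B, IsPartitionSeq s ∧ r (eqBB (fun n => f (s n)) t) ∈ E := by
  refine ⟨_, isPartitionSeq_update_zero hB (a := fun n => r (t n)) fun m n hmn => ?_,
    hE.2.1 _ h _ ((isLUB_iSup_of_countable hB _).2 ?_)⟩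
  · rw [← map_inf, ht.1 m n hmn, map_bot]
  · rintro _ ⟨n, rfl⟩
    refine le_trans ?_ (OrderHomClass.mono r ((isLUB_eqBB hC _ _).1 ⟨n, rfl⟩))
    rw [map_inf, hrf]
    refine le_inf ?_ le_rfl
    rcases eq_or_ne n 0 with rfl | hn
    · simp
    · simp [hn]

end CountablyComplete

/-- Let `B ⊆ C` be countably complete Boolean algebras (inclusion `f : B → C`
preserving the Boolean operations and countable suprema), `E` an ultrafilter on `B`,
`r : C → B` a retraction, and `E' = r⁻¹(E)`.  Then `E'` is an ultrafilter on `C`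
extending `E`; the image of `ω^B/E` under `i : t_E ↦ t_{E'}` (which sends the class
of `s` to the class of `f ∘ s`) is an initial segment of `ω^C/E'`; and for
`t ∈ C^(ω)`, the class `t_{E'}` lies in that image iff `⋁ₙ r (t n) ∈ E`. -/
theorem retraction_initial_segment
    {B : Type u} [BooleanAlgebra B] [SupSet B]
    (hB : ∀ S : Set B, S.Countable → IsLUB S (sSup S))
    {C : Type v} [BooleanAlgebra C] [SupSet C]
    (hC : ∀ S : Set C, S.Countable → IsLUB S (sSup S))
    (f : B → C) (hfinj : Function.Injective f)
    (hfsup : ∀ x y : B, f (x ⊔ y) = f x ⊔ f y)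
    (hfcompl : ∀ x : B, f xᶜ = (f x)ᶜ)
    (hfSup : ∀ S : Set B, S.Countable → f (sSup S) = sSup (f '' S))
    (r : C → B)
    (hrsup : ∀ x y : C, r (x ⊔ y) = r x ⊔ r y)
    (hrcompl : ∀ x : C, r xᶜ = (r x)ᶜ)
    (hrf : ∀ b : B, r (f b) = b)
    (E : Set B) (hE : IsUltrafilterOn E)
    (E' : Set C) (hE'def : E' = {c : C | r c ∈ E}) :
    -- E' is an ultrafilter on C extending E
    IsUltrafilterOn E' ∧ (∀ b ∈ E, f b ∈ E') ∧
      ∃ i : BUP E → BUP E',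
        -- i is the map t_E ↦ t_{E'}
        (∀ (s : {u : ℕ → B // IsPartitionSeq u})
            (s' : {u : ℕ → C // IsPartitionSeq u}),
          (∀ n, s'.1 n = f (s.1 n)) → i (Quot.mk _ s) = Quot.mk _ s') ∧
        -- the image of i is an initial segment of ω^C/E'
        (∀ x ∈ Set.range i, ∀ y : BUP E', y < x → y ∈ Set.range i) ∧
        -- characterization of the image
        (∀ t : {u : ℕ → C // IsPartitionSeq u},
          Quot.mk _ t ∈ Set.range i ↔ (⨆ n, r (t.1 n)) ∈ E) := by
  obtain ⟨f, rfl⟩ : ∃ g : BoundedLatticeHom B C, ⇑g = f :=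
    ⟨boundedLatticeHomOfSupCompl f hfsup hfcompl, rfl⟩
  obtain ⟨r, rfl⟩ : ∃ g : BoundedLatticeHom C B, ⇑g = r :=
    ⟨boundedLatticeHomOfSupCompl r hrsup hrcompl, rfl⟩
  obtain rfl : E' = r ⁻¹' E := hE'def
  let i : BUP E → BUP (r ⁻¹' E) := Quot.map (fun s => ⟨fun n => f (s.1 n), s.2.map f hfSup⟩)
    fun s t hst => by
      rw [← map_eqBB f hfSup, Set.mem_preimage, hrf]
      exact hst
  have hrange : ∀ t : {u : ℕ → C // IsPartitionSeq u},
      Quot.mk _ t ∈ Set.range i ↔ (⨆ n, r (t.1 n)) ∈ E := by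
    refine fun t => ⟨?_, fun h => ?_⟩
    · rintro ⟨⟨s⟩, hs⟩
      refine (hE.iSup_map_mem_congr hB hC r hs).1 ?_
      simp only [hrf, s.2.2]
      exact hE.2.1 _ ((hE.2.2.2 ⊥).resolve_left hE.1) _ le_top
    · obtain ⟨s, hs, hst⟩ := hE.exists_eqBB_map_mem hB hC f r hrf t.2 h
      exact ⟨Quot.mk _ ⟨s, hs⟩, Quot.sound hst⟩
  refine ⟨hE.preimage r, fun b hb => ?_, i, fun s s' hs => ?_, ?_, hrange⟩
  · rwa [Set.mem_preimage, hrf]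
  · exact congrArg (Quot.mk _) (Subtype.ext (funext fun n => (hs n).symm))
  · rintro x hx y ⟨s, t, rfl, rfl, hst⟩
    exact (hrange s).2 (hE.iSup_map_mem_of_ltBB_mem hB hC r t.2 hst ((hrange t).1 hx))
end

section
/- Let B be a countably complete Boolean algebra, let C be a subalgebra of B, and let (a_n)_{n∈ω} be a sequence in B that is independent over C. Let I be the ideal of B generated by {a_n : n ∈ ω} ∪ {-(⋁_{n∈ω} a_n)}. Then I ∩ C = {0}. -/
/-- The ideal of `B` generated by `S`: the smallest subset of `B` containing `S`
and `⊥` that is closed downward and under finite joins. -/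
def idealGen {B : Type*} [BooleanAlgebra B] (S : Set B) : Set B :=
  ⋂₀ {I : Set B | S ⊆ I ∧ ⊥ ∈ I ∧ (∀ x ∈ I, ∀ y : B, y ≤ x → y ∈ I) ∧
      ∀ x ∈ I, ∀ y ∈ I, x ⊔ y ∈ I}

/-- Let `B` be a countably complete Boolean algebra, `C` a subalgebra of `B`, and
`(a_n)` a sequence in `B` independent over `C`.  If `I` is the ideal of `B`
generated by `{a_n : n < ω} ∪ {(⋁ₙ a_n)ᶜ}`, then `I ∩ C = {⊥}`. -/
theorem ideal_inter_subalgebra_eq_bot {B : Type u} [BooleanAlgebra B] [SupSet B]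
    (hB : ∀ S : Set B, S.Countable → IsLUB S (sSup S))
    (C : Set B) (hC : IsSubalgebraSet C)
    (a : ℕ → B)
    (hind : ∀ s : Finset ℕ, ∀ h : ℕ → Bool, ∀ c ∈ C, c ≠ ⊥ →
      c ⊓ s.inf (fun n => if h n then a n else (a n)ᶜ) ≠ ⊥) :
    idealGen ({x | ∃ n : ℕ, x = a n} ∪ {(⨆ n, a n)ᶜ}) ∩ C = {⊥} := by
  have hs : IsLUB (Set.range a) (⨆ n, a n) := hB _ (Set.countable_range a)
  generalize (⨆ n, a n) = s at hs ⊢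
  apply Set.eq_singleton_iff_unique_mem.2
  refine ⟨⟨fun I hI => hI.2.1, hC.1⟩, ?_⟩
  rintro c ⟨hcI, hcC⟩
  obtain ⟨n, hn⟩ : c ∈ {x | ∃ n : ℕ, x ≤ (Finset.range n).sup a ⊔ sᶜ} := by
    refine hcI _ ⟨?_, ⟨0, bot_le⟩, fun x ⟨n, hn⟩ y hy => ⟨n, hy.trans hn⟩, ?_⟩
    · rintro x (⟨n, rfl⟩ | rfl)
      · exact ⟨n + 1, le_sup_of_le_left (Finset.le_sup (Finset.self_mem_range_succ n))⟩
      · exact ⟨0, le_sup_right⟩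
    · rintro x ⟨m, hm⟩ y ⟨n, hn⟩
      refine ⟨max m n, sup_le (hm.trans ?_) (hn.trans ?_)⟩
      · exact sup_le_sup_right (Finset.sup_mono (Finset.range_mono (le_max_left m n))) _
      · exact sup_le_sup_right (Finset.sup_mono (Finset.range_mono (le_max_right m n))) _
  by_contra hc
  let h : ℕ → Bool := fun i => decide (i = n)
  refine hind (Finset.range (n + 1)) h c hcC hc ?_
  set t := (Finset.range (n + 1)).inf fun i => if h i then a i else (a i)ᶜ
  have hts : t ≤ s := by
    have : t ≤ a n := by
      simpa [t, h] using Finset.inf_le (f := fun i => if h i then a i else (a i)ᶜ)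
        (Finset.self_mem_range_succ n)
    exact this.trans (hs.1 ⟨n, rfl⟩)
  have hta : Disjoint ((Finset.range n).sup a) t := by
    refine Finset.disjoint_sup_left.2 fun i hi => ?_
    have hin := Finset.mem_range.1 hi
    have : t ≤ (a i)ᶜ := by
      simpa [t, h, hin.ne] using Finset.inf_le (f := fun i => if h i then a i else (a i)ᶜ)
        (Finset.mem_range.2 (hin.trans n.lt_succ_self))
    exact disjoint_compl_right.mono_right this
  exact ((hta.sup_left (disjoint_compl_left.mono_right hts)).mono_left hn).eq_bot
end
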